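/- Fix integers m ≥ 2, 1 ≤ t ≤ m−1 and 2 ≤ n ≤ m. Let k₁, …, k_{n−1} be smooth positive real-valued functions on an open interval J containing s₀, let p₀ ∈ ℝ^m, let ε₁, …, ε_n ∈ {−1,1}, and let F_{1,0}, …, F_{n,0} ∈ ℝ^m be vectors with ⟪F_{i,0},F_{j,0}⟫_t = ε_iδ_ij for all 1 ≤ i,j ≤ n. Then there exist an open interval I ⊆ J containing s₀, a smooth curve γ : I → ℝ^m and smooth maps F₁, …, F_n : I → ℝ^m such that: γ(s₀) = p₀; F_i(s₀) = F_{i,0} for all i; F₁ = γ′ (so γ is unit-speed with ⟪γ′,γ′⟫_t = ε₁); ⟪F_i(s),F_j(s)⟫_t = ε_iδ_ij for all s ∈ I and all i,j; and the Frenet equations hold on I: F₁′ = ε₂k₁F₂, F_i′ = −ε_{i−1}k_{i−1}F_{i−1} + ε_{i+1}k_iF_{i+1} for 1 < i < n, and F_n′ = −ε_{n−1}k_{n−1}F_{n−1}. (This is the flat pseudo-Euclidean case of the Fundamental Theorem of Curves in semi-Riemannian geometry: in ℝ^m_t the covariant derivative along a curve is ordinary differentiation.) -/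

import Mathlib

open scoped BigOperators

noncomputable section

/-- The pseudo-Euclidean bilinear form of index `t` on `ℝⁿ` (modelled as `Fin n → ℝ`):
`⟪x,y⟫_t = −∑_{i<t} x_i y_i + ∑_{i≥t} x_i y_i`. -/
def pform (t : ℕ) {n : ℕ} (x y : Fin n → ℝ) : ℝ :=
  ∑ i : Fin n, (if i.val < t then -(x i * y i) else x i * y i)

/-- The covariant derivative along `γ` induced on the quadric `⟪x,x⟫_t = 1/c`:
`∇X = X′ − c⟪X′,γ⟫_t γ`. -/
def cov (t : ℕ) {n : ℕ} (c : ℝ) (γ X : ℝ → Fin n → ℝ) : ℝ → Fin n → ℝ :=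
  fun s => deriv X s - (c * pform t (deriv X s) (γ s)) • γ s

/-- The curvature operator of the space form: `R(X,Y)Z = c(⟪Y,Z⟫_t X − ⟪X,Z⟫_t Y)`. -/
def curvOp (t : ℕ) {n : ℕ} (c : ℝ) (X Y Z : Fin n → ℝ) : Fin n → ℝ :=
  c • (pform t Y Z • X - pform t X Z • Y)

/-- The `r`-tension field of a curve `γ` in the space form:
`τ_r(γ) = ∇^{2r−1}T + ∑_{ℓ=0}^{r−2} (−1)^ℓ R(∇^{2r−3−ℓ}T, ∇^ℓT)T` with `T = γ′`. -/
def tensionField (t : ℕ) {n : ℕ} (c : ℝ) (r : ℕ) (γ : ℝ → Fin n → ℝ) (s : ℝ) : Fin n → ℝ :=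
  (cov t c γ)^[2*r-1] (deriv γ) s
    + ∑ ℓ ∈ Finset.range (r-1), ((-1 : ℝ)^ℓ) •
        curvOp t c ((cov t c γ)^[2*r-3-ℓ] (deriv γ) s) ((cov t c γ)^[ℓ] (deriv γ) s) (deriv γ s)

open scoped Topology

section LinearSystem

variable {ι V : Type*} [Fintype ι] [NormedAddCommGroup V] [NormedSpace ℝ V]

/-- The autonomous vector field on `ℝ × (ι → V)` whose integral curves are the graphs of the
solutions of the linear system `Φ_i′ = ∑_j M_ij Φ_j`. -/
def linearSystemField (M : ℝ → ι → ι → ℝ) (x : ℝ × (ι → V)) : ℝ × (ι → V) :=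
  (1, fun i => ∑ j, M x.1 i j • x.2 j)

theorem contDiffAt_linearSystemField {M : ℝ → ι → ι → ℝ} {x : ℝ × (ι → V)}
    (hM : ∀ i j, ContDiffAt ℝ 1 (fun s => M s i j) x.1) :
    ContDiffAt ℝ 1 (linearSystemField (V := V) M) x := by
  refine contDiffAt_const.prodMk (contDiffAt_pi.2 fun i => ContDiffAt.sum fun j _ => ?_)
  refine ((hM i j).comp x contDiffAt_fst).smul ?_
  exact contDiffAt_pi.1 contDiffAt_snd j

/-- A linear system with `C¹` coefficients has a local solution with given initial value. -/
theorem exists_linearSystem_solution [CompleteSpace V] {M : ℝ → ι → ι → ℝ} {s₀ : ℝ}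
    (hM : ∀ i j, ContDiffAt ℝ 1 (fun s => M s i j) s₀) (Φ₀ : ι → V) :
    ∃ Φ : ι → ℝ → V, (∀ i, Φ i s₀ = Φ₀ i) ∧
      ∀ᶠ s in 𝓝 s₀, ∀ i, HasDerivAt (Φ i) (∑ j, M s i j • Φ j s) s := by
  obtain ⟨α, hα₀, δ, hδ, hα⟩ :=
    ContDiffAt.exists_forall_mem_closedBall_exists_eq_forall_mem_Ioo_hasDerivAt₀
      (contDiffAt_linearSystemField (x := (s₀, Φ₀)) hM) s₀
  have hs₀ : s₀ ∈ Set.Ioo (s₀ - δ) (s₀ + δ) := ⟨by linarith, by linarith⟩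
  have htime : ∀ s ∈ Set.Ioo (s₀ - δ) (s₀ + δ), HasDerivAt (fun s => (α s).1) 1 s :=
    fun s hs => (hα s hs).fst
  have hid : Set.EqOn (fun s => (α s).1) id (Set.Ioo (s₀ - δ) (s₀ + δ)) := by
    refine isOpen_Ioo.eqOn_of_deriv_eq isPreconnected_Ioo
      (fun s hs => (htime s hs).differentiableAt.differentiableWithinAt)
      differentiableOn_id (fun s hs => ?_) hs₀ (by simp [hα₀])
    rw [(htime s hs).deriv, deriv_id]
  refine ⟨fun i s => (α s).2 i, fun i => by simp [hα₀], ?_⟩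
  filter_upwards [isOpen_Ioo.mem_nhds hs₀] with s hs i
  have h := hasDerivAt_pi.1 (hα s hs).snd i
  have hs' : (α s).1 = s := hid hs
  simpa only [linearSystemField, hs'] using h

/-- A solution of a linear system with `C¹` coefficients and zero initial value vanishes
locally. -/
theorem linearSystem_solution_eq_zero {M : ℝ → ι → ι → ℝ} {s₀ : ℝ}
    (hM : ∀ i j, ContDiffAt ℝ 1 (fun s => M s i j) s₀) {Φ : ι → ℝ → V}
    (hΦ₀ : ∀ i, Φ i s₀ = 0)
    (hΦ : ∀ᶠ s in 𝓝 s₀, ∀ i, HasDerivAt (Φ i) (∑ j, M s i j • Φ j s) s) :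
    ∀ᶠ s in 𝓝 s₀, ∀ i, Φ i s = 0 := by
  obtain ⟨K, U, hU, hK⟩ :=
    (contDiffAt_linearSystemField (x := (s₀, (0 : ι → V))) hM).exists_lipschitzOnWith
  have key : ∀ Ψ : ι → ℝ → V, (∀ i, Ψ i s₀ = 0) →
      (∀ᶠ s in 𝓝 s₀, ∀ i, HasDerivAt (Ψ i) (∑ j, M s i j • Ψ j s) s) →
      ∀ᶠ s in 𝓝 s₀, HasDerivAt (fun s => (s, fun i => Ψ i s))
        (linearSystemField M (s, fun i => Ψ i s)) s ∧ (s, fun i => Ψ i s) ∈ U := by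
    intro Ψ hΨ₀ hΨ
    have hd : ∀ᶠ s in 𝓝 s₀, HasDerivAt (fun s => (s, fun i => Ψ i s))
        (linearSystemField M (s, fun i => Ψ i s)) s := by
      filter_upwards [hΨ] with s hs
      exact (hasDerivAt_id s).prodMk (hasDerivAt_pi.2 hs)
    refine hd.and (hd.self_of_nhds.continuousAt.preimage_mem_nhds ?_)
    rwa [show (fun i => Ψ i s₀) = 0 from funext hΨ₀]
  have hzero := key (fun _ _ => 0) (fun _ => rfl)
    (Filter.Eventually.of_forall fun s i => by simpa using hasDerivAt_const s (0 : V))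
  have heq := ODE_solution_unique_of_eventually (v := fun _ => linearSystemField M)
    (s := fun _ => U) (Filter.Eventually.of_forall fun _ => hK) (key Φ hΦ₀ hΦ) hzero
    (by simp [hΦ₀])
  filter_upwards [heq] with s hs i
  exact congrFun (congrArg Prod.snd hs) i

/-- Solutions of a linear system with smooth coefficients are smooth. -/
theorem contDiffOn_linearSystem_solution {M : ℝ → ι → ι → ℝ} {I : Set ℝ} (hI : IsOpen I)
    (hM : ∀ i j, ContDiffOn ℝ (⊤ : ℕ∞) (fun s => M s i j) I) {Φ : ι → ℝ → V}
    (hΦ : ∀ s ∈ I, ∀ i, HasDerivAt (Φ i) (∑ j, M s i j • Φ j s) s) (i : ι) :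
    ContDiffOn ℝ (⊤ : ℕ∞) (Φ i) I := by
  refine contDiffOn_infty.2 fun r => ?_
  induction r generalizing i with
  | zero =>
    exact contDiffOn_zero.2 fun s hs => (hΦ s hs i).continuousAt.continuousWithinAt
  | succ r ih =>
    rw [Nat.cast_succ, contDiffOn_succ_iff_deriv_of_isOpen hI]
    refine ⟨fun s hs => (hΦ s hs i).differentiableAt.differentiableWithinAt, by simp, ?_⟩
    refine ContDiffOn.congr (f := fun s => ∑ j, M s i j • Φ j s) ?_ fun s hs => (hΦ s hs i).deriv
    exact ContDiffOn.sum fun j _ => (contDiffOn_infty.1 (hM i j) r).smul (ih j)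

end LinearSystem

section Gram

variable {t m : ℕ}

theorem pform_sum_smul_left {ι : Type*} (S : Finset ι) (c : ι → ℝ) (x : ι → Fin m → ℝ)
    (y : Fin m → ℝ) : pform t (∑ l ∈ S, c l • x l) y = ∑ l ∈ S, c l * pform t (x l) y := by
  simp only [pform, Finset.mul_sum]
  rw [Finset.sum_comm]
  refine Finset.sum_congr rfl fun a _ => ?_
  split_ifs <;> simp [Finset.sum_apply, Finset.sum_mul, mul_assoc]

theorem pform_comm (x y : Fin m → ℝ) : pform t x y = pform t y x := by
  simp only [pform, mul_comm]

theorem pform_sum_smul_right {ι : Type*} (S : Finset ι) (c : ι → ℝ) (x : ι → Fin m → ℝ)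
    (y : Fin m → ℝ) : pform t y (∑ l ∈ S, c l • x l) = ∑ l ∈ S, c l * pform t y (x l) := by
  simp only [pform_comm y, pform_sum_smul_left]

theorem HasDerivAt.pform {x y : ℝ → Fin m → ℝ} {x' y' : Fin m → ℝ} {s : ℝ}
    (hx : HasDerivAt x x' s) (hy : HasDerivAt y y' s) :
    HasDerivAt (fun s => pform t (x s) (y s)) (pform t x' (y s) + pform t (x s) y') s := by
  simp only [_root_.pform, ← Finset.sum_add_distrib]
  refine HasDerivAt.fun_sum fun a _ => ?_
  have h := (hasDerivAt_pi.1 hx a).fun_mul (hasDerivAt_pi.1 hy a)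
  split_ifs
  · exact h.fun_neg.congr_deriv (by ring)
  · exact h

/-- If the constant matrix `E` satisfies `M E + E Mᵀ = 0`, then the Gram matrix of a solution
of `Φ′ = M Φ` which equals `E` initially stays equal to `E`. -/
theorem gram_eq_of_linearSystem {ι : Type*} [Fintype ι] {M : ℝ → ι → ι → ℝ} {s₀ : ℝ}
    (hM : ∀ i j, ContDiffAt ℝ 1 (fun s => M s i j) s₀) {Φ : ι → ℝ → Fin m → ℝ}
    (hΦ : ∀ᶠ s in 𝓝 s₀, ∀ i, HasDerivAt (Φ i) (∑ j, M s i j • Φ j s) s)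
    {E : ι → ι → ℝ}
    (hE : ∀ᶠ s in 𝓝 s₀, ∀ i j, ∑ l, M s i l * E l j + ∑ l, M s j l * E i l = 0)
    (hΦ₀ : ∀ i j, pform t (Φ i s₀) (Φ j s₀) = E i j) :
    ∀ᶠ s in 𝓝 s₀, ∀ i j, pform t (Φ i s) (Φ j s) = E i j := by
  classical
  have h := linearSystem_solution_eq_zero (ι := ι × ι) (s₀ := s₀)
    (M := fun s p q => M s p.1 q.1 * (if q.2 = p.2 then 1 else 0) +
      (if q.1 = p.1 then 1 else 0) * M s p.2 q.2)
    (Φ := fun p s => pform t (Φ p.1 s) (Φ p.2 s) - E p.1 p.2)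
    (fun p q => ((hM _ _).mul contDiffAt_const).add (contDiffAt_const.mul (hM _ _)))
    (fun p => sub_eq_zero.2 (hΦ₀ _ _)) ?_
  · filter_upwards [h] with s hs i j
    exact sub_eq_zero.1 (hs (i, j))
  · filter_upwards [hΦ, hE] with s hs hEs p
    refine (((hs p.1).pform (hs p.2)).sub_const _).congr_deriv ?_
    rw [pform_sum_smul_left, pform_sum_smul_right, Fintype.sum_prod_type]
    simp only [smul_eq_mul, add_mul, Finset.sum_add_distrib, mul_ite, ite_mul, mul_one, one_mul,
      mul_zero, zero_mul, Finset.sum_ite_eq', Finset.mem_univ, if_true, mul_sub,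
      Finset.sum_sub_distrib]
    rw [Finset.sum_comm (f := fun x y => if x = p.1 then M s p.2 y * pform t (Φ x s) (Φ y s) else 0),
      Finset.sum_comm (f := fun x y => if x = p.1 then M s p.2 y * E x y else 0)]
    simp only [Finset.sum_ite_eq', Finset.mem_univ, if_true]
    linarith [hEs p.1 p.2]

end Gram

/-- The coefficient matrix of the linear system satisfied by a Frenet curve (index `0`) together
with its frame fields (positive indices). -/
def frenetCoeff (ε : ℕ → ℝ) (k : ℕ → ℝ → ℝ) (s : ℝ) (i j : ℕ) : ℝ :=
  if i = 0 then (if j = 1 then 1 else 0)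
  else if j = i + 1 then ε j * k i s
  else if i = j + 1 ∧ j ≠ 0 then -(ε j * k j s)
  else 0

theorem contDiffOn_frenetCoeff {ε : ℕ → ℝ} {k : ℕ → ℝ → ℝ} {n : ℕ} {J : Set ℝ}
    (hk : ∀ i, 1 ≤ i → i ≤ n - 1 → ContDiffOn ℝ (⊤ : ℕ∞) (k i) J) {i j : ℕ}
    (hi : i ≤ n) (hj : j ≤ n) :
    ContDiffOn ℝ (⊤ : ℕ∞) (fun s => frenetCoeff ε k s i j) J := by
  unfold frenetCoeff
  split_ifs with h0 h1 h2 h3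
  · exact contDiffOn_const
  · exact contDiffOn_const
  · exact contDiffOn_const.mul (hk i (by omega) (by omega))
  · exact (contDiffOn_const.mul (hk j (by omega) (by omega))).neg
  · exact contDiffOn_const

theorem frenetCoeff_skew {ε : ℕ → ℝ} (k : ℕ → ℝ → ℝ) (s : ℝ) {i j : ℕ}
    (hi : i ≠ 0) (hj : j ≠ 0) (hεi : ε i = 1 ∨ ε i = -1) (hεj : ε j = 1 ∨ ε j = -1) :
    frenetCoeff ε k s i j * ε j + frenetCoeff ε k s j i * ε i = 0 := by
  have hi2 : ε i * ε i = 1 := by rcases hεi with h | h <;> simp [h]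
  have hj2 : ε j * ε j = 1 := by rcases hεj with h | h <;> simp [h]
  unfold frenetCoeff
  split_ifs <;> first | omega | skip
  · linear_combination k i s * hj2 - k i s * hi2
  · linear_combination k j s * hi2 - k j s * hj2
  · ring

theorem sum_frenetCoeff_zero {W : Type*} [AddCommGroup W] [Module ℝ W] (ε : ℕ → ℝ)
    (k : ℕ → ℝ → ℝ) (s : ℝ) {n : ℕ} (hn : 1 ≤ n) (x : ℕ → W) :
    ∑ j ∈ Finset.range (n + 1), frenetCoeff ε k s 0 j • x j = x 1 := by
  simp [frenetCoeff, ite_smul, show n ≠ 0 by omega]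

theorem sum_frenetCoeff {W : Type*} [AddCommGroup W] [Module ℝ W] (ε : ℕ → ℝ)
    (k : ℕ → ℝ → ℝ) (s : ℝ) {n i : ℕ} (hi : 1 ≤ i) (hin : i ≤ n) (x : ℕ → W) :
    ∑ j ∈ Finset.range (n + 1), frenetCoeff ε k s i j • x j =
      (if 1 < i then (-(ε (i - 1) * k (i - 1) s)) • x (i - 1) else 0) +
        (if i < n then (ε (i + 1) * k i s) • x (i + 1) else 0) := by
  have h : ∀ j, frenetCoeff ε k s i j • x j =
      (if j = i - 1 then
        (if 1 < i then (-(ε (i - 1) * k (i - 1) s)) • x (i - 1) else 0) else 0) +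
      (if j = i + 1 then (ε (i + 1) * k i s) • x (i + 1) else 0) := by
    intro j
    unfold frenetCoeff
    split_ifs <;> first | omega | skip
    all_goals (subst_vars; simp)
  simp only [h, Finset.sum_add_distrib, Finset.sum_ite_eq', Finset.mem_range]
  congr 1
  · rw [if_pos (by omega)]
  · simp

/-- The Fundamental Theorem of Curves in the flat pseudo-Euclidean space
`ℝ^m_t`: given curvature functions, an initial point and an initial orthonormal frame,
there exists an `n`-Frenet curve realizing them. -/
theorem stmt_19 (m t n : ℕ) (hm : 2 ≤ m) (ht1 : 1 ≤ t) (ht2 : t ≤ m - 1)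
    (hn1 : 2 ≤ n) (hn2 : n ≤ m)
    (J : Set ℝ) (hJopen : IsOpen J) (hJconn : J.OrdConnected) (s₀ : ℝ) (hs₀ : s₀ ∈ J)
    (k : ℕ → ℝ → ℝ)
    (hk : ∀ i, 1 ≤ i → i ≤ n - 1 → ContDiffOn ℝ (⊤ : ℕ∞) (k i) J)
    (hkpos : ∀ i, 1 ≤ i → i ≤ n - 1 → ∀ s ∈ J, 0 < k i s)
    (p₀ : Fin m → ℝ)
    (ε : ℕ → ℝ) (hε : ∀ i, 1 ≤ i → i ≤ n → ε i = 1 ∨ ε i = -1)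
    (F₀ : ℕ → Fin m → ℝ)
    (hF₀ : ∀ i, 1 ≤ i → i ≤ n → ∀ j, 1 ≤ j → j ≤ n →
      pform t (F₀ i) (F₀ j) = if i = j then ε i else 0) :
    ∃ (I : Set ℝ) (γ : ℝ → Fin m → ℝ) (F : ℕ → ℝ → Fin m → ℝ),
      I ⊆ J ∧ IsOpen I ∧ s₀ ∈ I ∧
      ContDiffOn ℝ (⊤ : ℕ∞) γ I ∧
      (∀ i, 1 ≤ i → i ≤ n → ContDiffOn ℝ (⊤ : ℕ∞) (F i) I) ∧
      γ s₀ = p₀ ∧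
      (∀ i, 1 ≤ i → i ≤ n → F i s₀ = F₀ i) ∧
      (∀ s ∈ I, deriv γ s = F 1 s) ∧
      (∀ i, 1 ≤ i → i ≤ n → ∀ j, 1 ≤ j → j ≤ n → ∀ s ∈ I,
        pform t (F i s) (F j s) = if i = j then ε i else 0) ∧
      (∀ s ∈ I, deriv (F 1) s = (ε 2 * k 1 s) • F 2 s) ∧
      (∀ i, 1 < i → i < n → ∀ s ∈ I,
        deriv (F i) s =
          (-(ε (i-1) * k (i-1) s)) • F (i-1) s + (ε (i+1) * k i s) • F (i+1) s) ∧
      (∀ s ∈ I, deriv (F n) s = (-(ε (n-1) * k (n-1) s)) • F (n-1) s) := by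
  have hMJ : ∀ i j : Fin (n + 1),
      ContDiffOn ℝ (⊤ : ℕ∞) (fun s => frenetCoeff ε k s i j) J := fun i j =>
    contDiffOn_frenetCoeff hk (Nat.lt_succ_iff.1 i.2) (Nat.lt_succ_iff.1 j.2)
  have hM : ∀ i j : Fin (n + 1), ContDiffAt ℝ 1 (fun s => frenetCoeff ε k s i j) s₀ :=
    fun i j => ((hMJ i j).contDiffAt (hJopen.mem_nhds hs₀)).of_le (by exact_mod_cast le_top)
  obtain ⟨Φ, hΦ₀, hΦ⟩ := exists_linearSystem_solution hM
    (fun i => if (i : ℕ) = 0 then p₀ else F₀ i)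
  have hgram : ∀ᶠ s in 𝓝 s₀, ∀ i j : Fin n,
      pform t (Φ i.succ s) (Φ j.succ s) = if i = j then ε (i + 1) else 0 := by
    refine gram_eq_of_linearSystem (Φ := fun i : Fin n => Φ i.succ)
      (M := fun s i j => frenetCoeff ε k s (i.succ : ℕ) (j.succ : ℕ))
      (fun i j => hM i.succ j.succ) ?_ (Filter.Eventually.of_forall fun s i j => ?_) ?_
    · filter_upwards [hΦ] with s hs i
      have h := hs i.succ
      rw [Fin.sum_univ_succ] at h
      simpa [frenetCoeff] using h
    · have h := frenetCoeff_skew k s (Nat.succ_ne_zero i) (Nat.succ_ne_zero j)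
        (hε (i + 1) (by omega) (by omega)) (hε (j + 1) (by omega) (by omega))
      simpa using h
    · intro i j
      simpa [hΦ₀, Fin.ext_iff] using
        hF₀ (i + 1) (by omega) (by omega) (j + 1) (by omega) (by omega)
  obtain ⟨I, hI, hIopen, hsI⟩ :=
    eventually_nhds_iff.1 ((hΦ.and hgram).and (hJopen.mem_nhds hs₀))
  have hIJ : I ⊆ J := fun s hs => (hI s hs).2
  let F : ℕ → ℝ → Fin m → ℝ := fun i => if h : i < n + 1 then Φ ⟨i, h⟩ else 0
  have hF : ∀ (i : ℕ) (h : i < n + 1), F i = Φ ⟨i, h⟩ := fun i h => dif_pos h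
  have hsmooth : ∀ i ≤ n, ContDiffOn ℝ (⊤ : ℕ∞) (F i) I := fun i hi => by
    rw [hF i (by omega)]
    exact contDiffOn_linearSystem_solution hIopen (fun i j => (hMJ i j).mono hIJ)
      (fun s hs => (hI s hs).1.1) _
  have hderiv : ∀ i ≤ n, ∀ s ∈ I,
      deriv (F i) s = ∑ j ∈ Finset.range (n + 1), frenetCoeff ε k s i j • F j s := by
    intro i hi s hs
    rw [hF i (by omega), ((hI s hs).1.1 _).deriv, Finset.sum_range]
    exact Finset.sum_congr rfl fun j _ => by rw [hF j j.2]
  refine ⟨I, F 0, F, hIJ, hIopen, hsI, hsmooth 0 (by omega), fun i _ hi => hsmooth i hi,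
    ?_, ?_, ?_, ?_, ?_, ?_, ?_⟩
  · simp [hF 0 (by omega), hΦ₀]
  · intro i hi hin
    simp [hF i (by omega), hΦ₀, show i ≠ 0 by omega]
  · intro s hs
    rw [hderiv 0 (by omega) s hs, sum_frenetCoeff_zero ε k s (by omega) fun j => F j s]
  · intro i hi hin j hj hjn s hs
    obtain ⟨i, rfl⟩ := Nat.exists_eq_add_of_le' hi
    obtain ⟨j, rfl⟩ := Nat.exists_eq_add_of_le' hj
    rw [hF _ (by omega), hF _ (by omega)]
    refine ((hI s hs).1.2 ⟨i, by omega⟩ ⟨j, by omega⟩).trans ?_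
    simp [Fin.ext_iff]
  · intro s hs
    rw [hderiv 1 (by omega) s hs, sum_frenetCoeff ε k s le_rfl (by omega) fun j => F j s]
    simp [show 1 < n by omega]
  · intro i hi hin s hs
    rw [hderiv i hin.le s hs, sum_frenetCoeff ε k s hi.le hin.le fun j => F j s]
    simp [hi, hin]
  · intro s hs
    rw [hderiv n le_rfl s hs, sum_frenetCoeff ε k s (by omega) le_rfl fun j => F j s]
    simp [show 1 < n by omega]
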